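/- Let 0 < λ < 1. Then, as k → 1⁻, cn(λK(k), k) ~ 2(k'/4)^{λ} and dn(λK(k), k) ~ 2(k'/4)^{λ}, in the sense that cn(λK(k), k)/(2(k'/4)^{λ}) → 1 and dn(λK(k), k)/(2(k'/4)^{λ}) → 1 as k → 1⁻, where k' = √(1−k²). -/

import Mathlib

open Real

/-- Complete elliptic integral of the first kind. -/
noncomputable def EllK (k : ℝ) : ℝ :=
  ∫ θ in (0:ℝ)..(π/2), 1 / Real.sqrt (1 - k^2 * Real.sin θ ^ 2)

/-- Complete elliptic integral of the second kind. -/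
noncomputable def EllE (k : ℝ) : ℝ :=
  ∫ θ in (0:ℝ)..(π/2), Real.sqrt (1 - k^2 * Real.sin θ ^ 2)

/-- Complementary complete elliptic integral `K'(k) = K(√(1-k²))`. -/
noncomputable def EllK' (k : ℝ) : ℝ := EllK (Real.sqrt (1 - k^2))

/-- Complementary elliptic integral of the second kind `E'(k) = E(√(1-k²))`. -/
noncomputable def EllE' (k : ℝ) : ℝ := EllE (Real.sqrt (1 - k^2))

/-- The nome `q = exp(-π K'(k)/K(k))`. -/
noncomputable def nome (k : ℝ) : ℝ := Real.exp (-π * EllK' k / EllK k)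

/-- Jacobi's theta function `Θ(u,k) = 1 + 2 ∑_{n≥1} (-1)^n q^{n²} cos(nπu/K)`. -/
noncomputable def JTheta (u k : ℝ) : ℝ :=
  1 + 2 * ∑' n : ℕ, (-1 : ℝ)^(n+1) * nome k ^ ((n+1)^2) *
    Real.cos (((n:ℝ)+1) * π * u / EllK k)

/-- Jacobi's theta function `H(u,k) = 2 ∑_{n≥0} (-1)^n q^{(n+1/2)²} sin((2n+1)πu/(2K))`. -/
noncomputable def JH (u k : ℝ) : ℝ :=
  2 * ∑' n : ℕ, (-1 : ℝ)^n * nome k ^ ((((n:ℝ) + 1/2)^2)) *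
    Real.sin ((2*(n:ℝ)+1) * π * u / (2 * EllK k))

/-- Jacobi's theta function `H₁(u,k) = 2 ∑_{n≥0} q^{(n+1/2)²} cos((2n+1)πu/(2K))`. -/
noncomputable def JH1 (u k : ℝ) : ℝ :=
  2 * ∑' n : ℕ, nome k ^ ((((n:ℝ) + 1/2)^2)) *
    Real.cos ((2*(n:ℝ)+1) * π * u / (2 * EllK k))

/-- Jacobi's theta function `Θ₁(u,k) = 1 + 2 ∑_{n≥1} q^{n²} cos(nπu/K)`. -/
noncomputable def JTheta1 (u k : ℝ) : ℝ :=
  1 + 2 * ∑' n : ℕ, nome k ^ ((n+1)^2) * Real.cos (((n:ℝ)+1) * π * u / EllK k)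

/-- Jacobi's zeta function `zn(u,k) = Θ_u(u,k)/Θ(u,k)`. -/
noncomputable def zn (u k : ℝ) : ℝ := deriv (fun v => JTheta v k) u / JTheta u k

/-- Jacobi's elliptic sine `sn(u,k) = H(u,k)/(√k Θ(u,k))`. -/
noncomputable def sn (u k : ℝ) : ℝ := JH u k / (Real.sqrt k * JTheta u k)

/-- Jacobi's elliptic cosine `cn(u,k) = √(k'/k) H₁(u,k)/Θ(u,k)`. -/
noncomputable def cn (u k : ℝ) : ℝ :=
  Real.sqrt (Real.sqrt (1 - k^2) / k) * JH1 u k / JTheta u k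

/-- Jacobi's delta amplitude `dn(u,k) = √(k') Θ₁(u,k)/Θ(u,k)`. -/
noncomputable def dn (u k : ℝ) : ℝ :=
  Real.sqrt (Real.sqrt (1 - k^2)) * JTheta1 u k / JTheta u k

open Filter Topology HurwitzZeta

/-- Laplace asymptotics of the Gaussian lattice sum: for `|a| < 1/2` the term closest to the
origin dominates. -/
lemma tendsto_evenKernel_mul_exp {a : ℝ} (ha : |a| < 1 / 2) :
    Tendsto (fun x : ℝ => evenKernel a x * exp (π * a ^ 2 * x)) atTop (𝓝 1) := by
  have key : Tendsto (fun x : ℝ => ∑' n : ℤ, exp (-(π * (n ^ 2 + 2 * n * a) * x))) atTop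
      (𝓝 (∑' n : ℤ, if n = 0 then 1 else 0)) := by
    have hpos : ∀ n : ℤ, n ≠ 0 → 0 < (n : ℝ) ^ 2 + 2 * n * a := by
      intro n hn
      have h1 : (1 : ℝ) ≤ |(n : ℝ)| := by exact_mod_cast Int.one_le_abs hn
      have h2 : -(|(n : ℝ)| * |a|) ≤ n * a := by rw [← abs_mul]; exact neg_abs_le _
      have h3 : (n : ℝ) ^ 2 = |(n : ℝ)| ^ 2 := (sq_abs _).symm
      nlinarith
    have hsum : Summable fun n : ℤ => exp (-(π * (n ^ 2 + 2 * n * a))) := by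
      refine ((hasSum_int_evenKernel a one_pos).summable.mul_left (exp (π * a ^ 2))).congr
        fun n => ?_
      rw [← exp_add]
      ring_nf
    refine tendsto_tsum_of_dominated_convergence hsum (fun n => ?_) ?_
    · split_ifs with hn
      · simp [hn]
      · exact tendsto_exp_neg_atTop_nhds_zero.comp
          (tendsto_id.const_mul_atTop (mul_pos pi_pos (hpos n hn)))
    · filter_upwards [eventually_ge_atTop 1] with x hx n
      rw [norm_of_nonneg (exp_pos _).le, exp_le_exp, neg_le_neg_iff]
      refine le_mul_of_one_le_right (mul_nonneg pi_pos.le ?_) hx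
      rcases eq_or_ne n 0 with rfl | hn
      · simp
      · exact (hpos n hn).le
  rw [tsum_ite_eq] at key
  refine key.congr' ?_
  filter_upwards [eventually_gt_atTop 0] with x hx
  rw [← (hasSum_int_evenKernel a hx).tsum_eq, ← tsum_mul_right]
  refine tsum_congr fun n => ?_
  rw [← exp_add]
  ring_nf

lemma cosKernel_one_div (a : UnitAddCircle) {x : ℝ} (hx : 0 < x) :
    cosKernel a (1 / x) = √x * evenKernel a x := by
  rw [evenKernel_functional_equation, ← sqrt_eq_rpow]
  field_simp

lemma nome_pow (k : ℝ) (n : ℕ) : nome k ^ n = exp (-π * n * (EllK' k / EllK k)) := by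
  rw [nome, ← exp_nat_mul]
  ring_nf

lemma JTheta1_eq_cosKernel (lam : ℝ) {k : ℝ} (hK : 0 < EllK k) (hK' : 0 < EllK' k) :
    JTheta1 (lam * EllK k) k = cosKernel (lam / 2 : ℝ) (EllK' k / EllK k) := by
  have h := hasSum_nat_cosKernel₀ (lam / 2) (div_pos hK' hK)
  rw [JTheta1, ← tsum_mul_left, sub_eq_iff_eq_add'.mp h.tsum_eq.symm]
  congr 1
  refine tsum_congr fun n => ?_
  rw [nome_pow]
  push_cast
  rw [show ((n : ℝ) + 1) * π * (lam * EllK k) / EllK k = 2 * π * (lam / 2) * (n + 1) by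
    field_simp]
  ring

lemma JTheta_eq_cosKernel (lam : ℝ) {k : ℝ} (hK : 0 < EllK k) (hK' : 0 < EllK' k) :
    JTheta (lam * EllK k) k = cosKernel ((lam - 1) / 2 : ℝ) (EllK' k / EllK k) := by
  have h := hasSum_nat_cosKernel₀ ((lam - 1) / 2) (div_pos hK' hK)
  rw [JTheta, ← tsum_mul_left, sub_eq_iff_eq_add'.mp h.tsum_eq.symm]
  congr 1
  refine tsum_congr fun n => ?_
  rw [nome_pow, show 2 * π * ((lam - 1) / 2) * (n + 1) =
    ((n : ℝ) + 1) * π * (lam * EllK k) / EllK k - (n + 1 : ℕ) * π by push_cast; field_simp,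
    cos_sub_nat_mul_pi]
  push_cast
  ring

/-- The odd-indexed part of the sum defining `cosKernel (a / 2) (t / 4)`. -/
lemma tsum_cos_half_integer (a : ℝ) {t : ℝ} (ht : 0 < t) :
    ∑' n : ℕ, 2 * cos (π * a * (2 * n + 1)) * exp (-π * (n + 1 / 2) ^ 2 * t) =
      cosKernel (a / 2 : ℝ) (t / 4) - cosKernel a t := by
  have h := hasSum_nat_cosKernel₀ (a / 2) (div_pos ht four_pos)
  have h2 := hasSum_nat_cosKernel₀ a ht
  have hinj : Function.Injective fun n : ℕ => 2 * n := fun m n hmn => by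
    dsimp only at hmn
    omega
  have hinj' : Function.Injective fun n : ℕ => 2 * n + 1 := fun m n hmn => by
    dsimp only at hmn
    omega
  have hodd (n : ℕ) : 2 * cos (2 * π * (a / 2) * ((2 * n + 1 : ℕ) + 1)) *
      exp (-π * ((2 * n + 1 : ℕ) + 1) ^ 2 * (t / 4)) =
      2 * cos (2 * π * a * (n + 1)) * exp (-π * (n + 1) ^ 2 * t) := by
    push_cast
    ring_nf
  have heven (n : ℕ) : 2 * cos (2 * π * (a / 2) * ((2 * n : ℕ) + 1)) *
      exp (-π * ((2 * n : ℕ) + 1) ^ 2 * (t / 4)) =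
      2 * cos (π * a * (2 * n + 1)) * exp (-π * (n + 1 / 2) ^ 2 * t) := by
    push_cast
    ring_nf
  generalize hf : (fun n : ℕ => 2 * cos (2 * π * (a / 2) * (n + 1)) *
    exp (-π * (n + 1) ^ 2 * (t / 4))) = f at h
  have hsplit : ∑' n, f (2 * n) + ∑' n, f (2 * n + 1) = ∑' n, f n :=
    tsum_even_add_odd (h.summable.comp_injective hinj) (h.summable.comp_injective hinj')
  have hE : ∑' n, f (2 * n) =
      ∑' n : ℕ, 2 * cos (π * a * (2 * n + 1)) * exp (-π * (n + 1 / 2) ^ 2 * t) :=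
    tsum_congr fun n => by rw [← heven, ← hf]
  have hO : ∑' n, f (2 * n + 1) = cosKernel a t - 1 := by
    rw [← h2.tsum_eq]
    exact tsum_congr fun n => by rw [← hodd, ← hf]
  rw [hE, hO, h.tsum_eq] at hsplit
  linarith

lemma JH1_eq_cosKernel (lam : ℝ) {k : ℝ} (hK : 0 < EllK k) (hK' : 0 < EllK' k) :
    JH1 (lam * EllK k) k = cosKernel (lam / 2 / 2 : ℝ) (EllK' k / EllK k / 4) -
      cosKernel (lam / 2 : ℝ) (EllK' k / EllK k) := by
  rw [← tsum_cos_half_integer (lam / 2) (div_pos hK' hK), JH1, ← tsum_mul_left]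
  refine tsum_congr fun n => ?_
  rw [nome, ← exp_mul, show (2 * (n : ℝ) + 1) * π * (lam * EllK k) / (2 * EllK k) =
    π * (lam / 2) * (2 * n + 1) by field_simp,
    show -π * ((n : ℝ) + 1 / 2) ^ 2 * (EllK' k / EllK k) =
      -π * EllK' k / EllK k * ((n : ℝ) + 1 / 2) ^ 2 by ring]
  ring

lemma one_sub_sq_mul_sin_sq_pos {k : ℝ} (hk0 : 0 < k) (hk1 : k < 1) (θ : ℝ) :
    0 < 1 - k ^ 2 * sin θ ^ 2 := by
  nlinarith [sin_sq_add_cos_sq θ, sq_nonneg (cos θ), sq_nonneg (sin θ), mul_pos hk0 hk0]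

lemma continuous_inv_sqrt_one_sub {k : ℝ} (hk0 : 0 < k) (hk1 : k < 1) :
    Continuous fun θ : ℝ => 1 / √(1 - k ^ 2 * sin θ ^ 2) :=
  continuous_const.div (by fun_prop)
    fun θ => (sqrt_pos.mpr (one_sub_sq_mul_sin_sq_pos hk0 hk1 θ)).ne'

lemma integral_sin_div_sqrt {k : ℝ} (hk0 : 0 < k) (hk1 : k < 1) :
    ∫ θ in (0 : ℝ)..(π / 2), sin θ * (1 / √(1 - k ^ 2 * sin θ ^ 2)) =
      (log (1 + k) - log √(1 - k ^ 2)) / k := by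
  have hs : 0 < 1 - k ^ 2 := by nlinarith
  have hk' : 0 < √(1 - k ^ 2) := sqrt_pos.mpr hs
  have hsq : √(1 - k ^ 2) ^ 2 = 1 - k ^ 2 := sq_sqrt hs.le
  have hderiv : ∀ θ ∈ Set.uIcc 0 (π / 2),
      HasDerivAt (fun θ => -(arsinh (k / √(1 - k ^ 2) * cos θ) / k))
        (sin θ * (1 / √(1 - k ^ 2 * sin θ ^ 2))) θ := by
    intro θ _
    convert! ((((hasDerivAt_cos θ).const_mul (k / √(1 - k ^ 2))).arsinh).div_const k).neg using 1
    have h : √(1 + (k / √(1 - k ^ 2) * cos θ) ^ 2) =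
        √(1 - k ^ 2 * sin θ ^ 2) / √(1 - k ^ 2) := by
      rw [← sqrt_div' _ hs.le]
      congr 1
      rw [mul_pow, div_pow, hsq, sin_sq]
      field_simp
      ring
    have := sqrt_pos.mpr (one_sub_sq_mul_sin_sq_pos hk0 hk1 θ)
    rw [h, smul_eq_mul]
    field_simp
  rw [intervalIntegral.integral_eq_sub_of_hasDerivAt hderiv
    ((continuous_sin.mul (continuous_inv_sqrt_one_sub hk0 hk1)).intervalIntegrable _ _)]
  have harsinh : arsinh (k / √(1 - k ^ 2)) = log (1 + k) - log √(1 - k ^ 2) := by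
    have h : √(1 + (k / √(1 - k ^ 2)) ^ 2) = 1 / √(1 - k ^ 2) := by
      rw [div_pow, hsq, show 1 + k ^ 2 / (1 - k ^ 2) = 1 / (1 - k ^ 2) by field_simp; ring,
        sqrt_div' _ hs.le, sqrt_one]
    rw [arsinh, h, ← log_div (by positivity) hk'.ne']
    ring_nf
  simp [harsinh]

lemma tendsto_integral_one_sub_sin :
    Tendsto (fun k : ℝ => ∫ θ in (0 : ℝ)..(π / 2), (1 - sin θ) * (1 / √(1 - k ^ 2 * sin θ ^ 2)))
      (𝓝[<] 1) (𝓝 (log 2)) := by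
  have hlim : ∫ θ in (0 : ℝ)..(π / 2), cos θ / (1 + sin θ) = log 2 := by
    have hpos : ∀ θ ∈ Set.uIcc 0 (π / 2), 0 < 1 + sin θ := by
      intro θ hθ
      rw [Set.uIcc_of_le (by positivity)] at hθ
      linarith [sin_nonneg_of_nonneg_of_le_pi hθ.1 (by linarith [hθ.2, pi_pos])]
    have hderiv : ∀ θ ∈ Set.uIcc 0 (π / 2),
        HasDerivAt (fun θ => log (1 + sin θ)) (cos θ / (1 + sin θ)) θ :=
      fun θ hθ => ((hasDerivAt_sin θ).const_add 1).log (hpos θ hθ).ne'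
    rw [intervalIntegral.integral_eq_sub_of_hasDerivAt hderiv]
    · norm_num
    · exact (continuous_cos.continuousOn.div (by fun_prop)
        fun θ hθ => (hpos θ hθ).ne').intervalIntegrable
  rw [← hlim]
  have hmem : ∀ᶠ k : ℝ in 𝓝[<] 1, k ∈ Set.Ioo (0 : ℝ) 1 := Ioo_mem_nhdsLT one_pos
  refine intervalIntegral.tendsto_integral_filter_of_dominated_convergence (fun _ => 1) ?_ ?_
    intervalIntegrable_const ?_
  · filter_upwards [hmem] with k hk
    exact ((by fun_prop : Continuous fun θ : ℝ => 1 - sin θ).mul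
      (continuous_inv_sqrt_one_sub hk.1 hk.2)).aestronglyMeasurable
  · filter_upwards [hmem] with k hk
    refine .of_forall fun θ hθ => ?_
    rw [Set.uIoc_of_le (by positivity)] at hθ
    have h0 := sin_nonneg_of_nonneg_of_le_pi hθ.1.le (by linarith [hθ.2, pi_pos])
    have h1 := sin_le_one θ
    have hp := one_sub_sq_mul_sin_sq_pos hk.1 hk.2 θ
    rw [norm_of_nonneg (mul_nonneg (by linarith) (by positivity)), mul_one_div,
      div_le_one (sqrt_pos.mpr hp)]
    apply le_sqrt_of_sq_le
    have : k ^ 2 ≤ 1 := by nlinarith [hk.1, hk.2]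
    nlinarith [mul_nonneg (sub_nonneg.mpr this) (sq_nonneg (sin θ))]
  · have hne : ∀ᵐ θ : ℝ, θ ≠ π / 2 := by
      simp [MeasureTheory.ae_iff]
    filter_upwards [hne] with θ hθ' hθ
    rw [Set.uIoc_of_le (by positivity)] at hθ
    have hcos : 0 < cos θ := cos_pos_of_mem_Ioo
      ⟨by linarith [hθ.1, pi_pos], lt_of_le_of_ne hθ.2 hθ'⟩
    have h0 := sin_nonneg_of_nonneg_of_le_pi hθ.1.le (by linarith [hθ.2, pi_pos])
    have hval : cos θ / (1 + sin θ) = (1 - sin θ) * (1 / √(1 - 1 ^ 2 * sin θ ^ 2)) := by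
      rw [one_pow, one_mul, ← cos_sq', sqrt_sq hcos.le]
      have := sin_sq_add_cos_sq θ
      field_simp
      linarith
    rw [hval]
    have hc : ContinuousAt (fun k : ℝ => (1 - sin θ) * (1 / √(1 - k ^ 2 * sin θ ^ 2))) 1 := by
      refine continuousAt_const.mul (continuousAt_const.div (by fun_prop) ?_)
      rw [one_pow, one_mul, ← cos_sq', sqrt_sq hcos.le]
      exact hcos.ne'
    exact hc.tendsto.mono_left nhdsWithin_le_nhds

lemma EllK_eq_add {k : ℝ} (hk0 : 0 < k) (hk1 : k < 1) :
    EllK k = (log (1 + k) - log √(1 - k ^ 2)) / k +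
      ∫ θ in (0 : ℝ)..(π / 2), (1 - sin θ) * (1 / √(1 - k ^ 2 * sin θ ^ 2)) := by
  have hc := continuous_inv_sqrt_one_sub hk0 hk1
  have h₁ : Continuous fun θ : ℝ => sin θ * (1 / √(1 - k ^ 2 * sin θ ^ 2)) :=
    continuous_sin.mul hc
  have h₂ : Continuous fun θ : ℝ => (1 - sin θ) * (1 / √(1 - k ^ 2 * sin θ ^ 2)) :=
    (continuous_const.sub continuous_sin).mul hc
  rw [← integral_sin_div_sqrt hk0 hk1, ← intervalIntegral.integral_add
    (h₁.intervalIntegrable _ _) (h₂.intervalIntegrable _ _), EllK]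
  congr 1
  ext θ
  ring

lemma tendsto_one_sub_mul_log_sqrt :
    Tendsto (fun k : ℝ => (1 - k) * log √(1 - k ^ 2)) (𝓝[<] 1) (𝓝 0) := by
  have hc : ContinuousAt (fun k : ℝ => (1 - k ^ 2) * log (1 - k ^ 2) / (2 * (1 + k))) 1 :=
    ContinuousAt.div (continuous_mul_log.comp
      (by fun_prop : Continuous fun k : ℝ => 1 - k ^ 2)).continuousAt (by fun_prop) (by norm_num)
  have h := hc.tendsto.mono_left (nhdsWithin_le_nhds (s := Set.Iio 1))
  norm_num at h
  refine h.congr' ?_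
  filter_upwards [Ioo_mem_nhdsLT (zero_lt_one (α := ℝ))] with k hk
  rw [log_sqrt (by nlinarith [hk.1, hk.2])]
  have : 1 + k ≠ 0 := by linarith [hk.1]
  field_simp
  ring

lemma tendsto_EllK_sub_log :
    Tendsto (fun k : ℝ => EllK k - log (4 / √(1 - k ^ 2))) (𝓝[<] 1) (𝓝 0) := by
  have hc : ContinuousAt (fun k : ℝ => log (1 + k) / k) 1 :=
    ContinuousAt.div (ContinuousAt.log (by fun_prop) (by norm_num)) continuousAt_id one_ne_zero
  have hinv : Tendsto (fun k : ℝ => k⁻¹) (𝓝[<] 1) (𝓝 1⁻¹) :=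
    (continuousAt_inv₀ one_ne_zero).tendsto.mono_left nhdsWithin_le_nhds
  have h := (((hc.tendsto.mono_left (nhdsWithin_le_nhds (s := Set.Iio 1))).sub
    (tendsto_one_sub_mul_log_sqrt.mul hinv)).add tendsto_integral_one_sub_sin).sub
      (tendsto_const_nhds (x := log 4))
  have h4 : log 4 = 2 * log 2 := by
    rw [show (4 : ℝ) = 2 ^ 2 by norm_num, log_pow]; norm_num
  have hz : log (1 + 1) / 1 - 0 * (1 : ℝ)⁻¹ + log 2 - log 4 = 0 := by
    rw [h4]; norm_num; ring
  rw [hz] at h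
  refine h.congr' ?_
  filter_upwards [Ioo_mem_nhdsLT (zero_lt_one (α := ℝ))] with k hk
  have hk' : 0 < √(1 - k ^ 2) := sqrt_pos.mpr (by nlinarith [hk.1, hk.2])
  have := hk.1
  rw [EllK_eq_add hk.1 hk.2, log_div four_ne_zero hk'.ne']
  field_simp
  ring

lemma pi_div_two_le_EllK {k : ℝ} (hk0 : 0 < k) (hk1 : k < 1) : π / 2 ≤ EllK k := by
  have h := intervalIntegral.integral_mono_on (μ := MeasureTheory.volume) (a := 0) (b := π / 2)
    (f := fun _ => (1 : ℝ)) (by positivity) intervalIntegrable_const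
    ((continuous_inv_sqrt_one_sub hk0 hk1).intervalIntegrable _ _) fun θ _ => by
      have hp := one_sub_sq_mul_sin_sq_pos hk0 hk1 θ
      rw [one_le_div (sqrt_pos.mpr hp), sqrt_le_one]
      nlinarith [sq_nonneg (k * sin θ)]
  simpa [EllK] using h

lemma EllK_mul_sqrt_le {k : ℝ} (hk0 : 0 < k) (hk1 : k < 1) :
    EllK k * √(1 - k ^ 2) ≤ π / 2 := by
  have hs : 0 < 1 - k ^ 2 := by nlinarith
  rw [← le_div_iff₀ (sqrt_pos.mpr hs)]
  have h := intervalIntegral.integral_mono_on (μ := MeasureTheory.volume) (a := 0) (b := π / 2)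
    (g := fun _ => 1 / √(1 - k ^ 2)) (by positivity)
    ((continuous_inv_sqrt_one_sub hk0 hk1).intervalIntegrable _ _) intervalIntegrable_const
    fun θ _ => by
      gcongr
      nlinarith [sin_sq_le_one θ, sq_nonneg k]
  rw [intervalIntegral.integral_const] at h
  refine h.trans_eq ?_
  simp only [smul_eq_mul]
  ring

lemma EllK'_bounds {k : ℝ} (hk0 : 0 < k) (hk1 : k < 1) :
    π / 2 ≤ EllK' k ∧ EllK' k * k ≤ π / 2 := by
  have hs : 0 < 1 - k ^ 2 := by nlinarith
  have h0 : 0 < √(1 - k ^ 2) := sqrt_pos.mpr hs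
  have h1 : √(1 - k ^ 2) < 1 := by
    rw [sqrt_lt' one_pos]
    nlinarith
  refine ⟨pi_div_two_le_EllK h0 h1, ?_⟩
  have h := EllK_mul_sqrt_le h0 h1
  rwa [sq_sqrt hs.le, sub_sub_cancel, sqrt_sq hk0.le] at h

/-- The complementary nome `exp (-π K / K')` is asymptotic to `(k' / 4)²`. -/
lemma tendsto_pi_mul_EllK_div_sub_log :
    Tendsto (fun k : ℝ => π * (EllK k / EllK' k) - 2 * log (4 / √(1 - k ^ 2)))
      (𝓝[<] 1) (𝓝 0) := by
  have hone : Tendsto (fun k : ℝ => 1 - k) (𝓝[<] 1) (𝓝 (1 - 1)) :=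
    ((continuous_const.sub continuous_id).tendsto 1).mono_left nhdsWithin_le_nhds
  rw [sub_self] at hone
  have hKone : Tendsto (fun k : ℝ => (1 - k) * EllK k) (𝓝[<] 1) (𝓝 0) := by
    have h := ((hone.mul tendsto_EllK_sub_log).add (hone.mul_const (log 4))).sub
      tendsto_one_sub_mul_log_sqrt
    simp only [zero_mul, add_zero, sub_zero] at h
    refine h.congr' ?_
    filter_upwards [Ioo_mem_nhdsLT (zero_lt_one (α := ℝ))] with k hk
    have hk' : 0 < √(1 - k ^ 2) := sqrt_pos.mpr (by nlinarith [hk.1, hk.2])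
    rw [log_div four_ne_zero hk'.ne']
    ring
  have hdiff : Tendsto (fun k : ℝ => 2 * EllK k - π * (EllK k / EllK' k)) (𝓝[<] 1) (𝓝 0) := by
    have h2 := hKone.const_mul 2
    rw [mul_zero] at h2
    refine squeeze_zero' ?_ ?_ h2
    all_goals
      filter_upwards [Ioo_mem_nhdsLT (zero_lt_one (α := ℝ))] with k hk
      obtain ⟨hl, hu⟩ := EllK'_bounds hk.1 hk.2
      have hK := pi_div_two_le_EllK hk.1 hk.2
      have hK0 : 0 < EllK k := by linarith [pi_pos]
      have hK'0 : 0 < EllK' k := by linarith [pi_pos]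
    · rw [sub_nonneg, ← mul_div_assoc, div_le_iff₀ hK'0]
      nlinarith
    · have : 2 * k * EllK k ≤ π * (EllK k / EllK' k) := by
        rw [← mul_div_assoc, le_div_iff₀ hK'0]
        nlinarith
      linarith
  have h := (tendsto_EllK_sub_log.const_mul 2).sub hdiff
  simp only [mul_zero, sub_zero] at h
  refine h.congr fun k => ?_
  ring

lemma tendsto_log_four_div_sqrt :
    Tendsto (fun k : ℝ => log (4 / √(1 - k ^ 2))) (𝓝[<] 1) atTop := by
  have h0 : Tendsto (fun k : ℝ => √(1 - k ^ 2)) (𝓝[<] 1) (𝓝 √(1 - 1 ^ 2)) :=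
    ((by fun_prop : Continuous fun k : ℝ => √(1 - k ^ 2)).tendsto 1).mono_left nhdsWithin_le_nhds
  norm_num at h0
  refine tendsto_log_atTop.comp (Tendsto.const_mul_atTop four_pos (tendsto_inv_nhdsGT_zero.comp
    (tendsto_nhdsWithin_iff.mpr ⟨h0, ?_⟩)))
  filter_upwards [Ioo_mem_nhdsLT (zero_lt_one (α := ℝ))] with k hk
  exact sqrt_pos.mpr (by nlinarith [hk.1, hk.2])

lemma tendsto_EllK_div_EllK' :
    Tendsto (fun k : ℝ => EllK k / EllK' k) (𝓝[<] 1) atTop := by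
  have h := (tendsto_pi_mul_EllK_div_sub_log.add_atTop
    (tendsto_log_four_div_sqrt.const_mul_atTop two_pos)).const_mul_atTop (inv_pos.mpr pi_pos)
  refine h.congr fun k => ?_
  field_simp
  ring

lemma cosKernel_one_div_eq_exp (a : ℝ) {x : ℝ} (hx : 0 < x) :
    cosKernel a (1 / x) =
      √x * exp (-(π * a ^ 2 * x)) * (evenKernel a x * exp (π * a ^ 2 * x)) := by
  rw [cosKernel_one_div _ hx, exp_neg]
  field_simp

lemma sqrt_mul_exp_div_rpow (lam x : ℝ) {y : ℝ} (hy : 0 < y) :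
    √y * (exp (-(π * (lam / 2) ^ 2 * x)) / exp (-(π * ((lam - 1) / 2) ^ 2 * x))) /
      (2 * (y / 4) ^ lam) = exp (-((2 * lam - 1) / 4 * (π * x - 2 * log (4 / y)))) := by
  have hsqrt : √y = 2 * exp (log (y / 4) * (1 / 2)) := by
    rw [← rpow_def_of_pos (by positivity), ← sqrt_eq_rpow, sqrt_div hy.le,
      show (4 : ℝ) = 2 ^ 2 by norm_num, sqrt_sq two_pos.le]
    ring
  rw [hsqrt, rpow_def_of_pos (by positivity), ← exp_sub, mul_assoc, ← exp_add,
    mul_div_mul_left _ _ two_ne_zero, ← exp_sub, log_div hy.ne' four_ne_zero,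
    log_div four_ne_zero hy.ne']
  ring_nf

theorem stmt_11 (lam : ℝ) (hlam : 0 < lam) (hlam' : lam < 1) :
    Filter.Tendsto (fun k : ℝ =>
        cn (lam * EllK k) k / (2 * (Real.sqrt (1 - k^2) / 4) ^ lam))
      (nhdsWithin 1 (Set.Iio (1:ℝ))) (nhds 1) ∧
    Filter.Tendsto (fun k : ℝ =>
        dn (lam * EllK k) k / (2 * (Real.sqrt (1 - k^2) / 4) ^ lam))
      (nhdsWithin 1 (Set.Iio (1:ℝ))) (nhds 1) := by
  set G : ℝ → ℝ → ℝ := fun a x => evenKernel a x * exp (π * a ^ 2 * x) with hG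
  set X : ℝ → ℝ := fun k => EllK k / EllK' k with hX
  have hG0 : Tendsto (fun k => G ((lam - 1) / 2) (X k)) (𝓝[<] 1) (𝓝 1) :=
    (tendsto_evenKernel_mul_exp (abs_lt.mpr ⟨by linarith, by linarith⟩)).comp
      tendsto_EllK_div_EllK'
  have hG1 : Tendsto (fun k => G (lam / 2) (X k)) (𝓝[<] 1) (𝓝 1) :=
    (tendsto_evenKernel_mul_exp (abs_lt.mpr ⟨by linarith, by linarith⟩)).comp
      tendsto_EllK_div_EllK'
  have hG2 : Tendsto (fun k => G (lam / 2 / 2) (4 * X k)) (𝓝[<] 1) (𝓝 1) :=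
    (tendsto_evenKernel_mul_exp (abs_lt.mpr ⟨by linarith, by linarith⟩)).comp
      (tendsto_EllK_div_EllK'.const_mul_atTop four_pos)
  have hexp : Tendsto (fun k : ℝ => exp (-((2 * lam - 1) / 4 *
      (π * X k - 2 * log (4 / √(1 - k ^ 2)))))) (𝓝[<] 1) (𝓝 1) := by
    have h := (continuous_exp.tendsto _).comp
      ((tendsto_pi_mul_EllK_div_sub_log.const_mul ((2 * lam - 1) / 4)).neg)
    rwa [mul_zero, neg_zero, exp_zero] at h
  have hsqrt : Tendsto (fun k : ℝ => √k) (𝓝[<] 1) (𝓝 1) := by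
    have h := (continuous_sqrt.tendsto 1).mono_left (nhdsWithin_le_nhds (s := Set.Iio 1))
    rwa [sqrt_one] at h
  have hforms : ∀ k ∈ Set.Ioo (0 : ℝ) 1, 0 < √(1 - k ^ 2) ∧ 0 < √(X k) ∧
      JTheta (lam * EllK k) k = √(X k) * exp (-(π * ((lam - 1) / 2) ^ 2 * X k)) *
        G ((lam - 1) / 2) (X k) ∧
      JTheta1 (lam * EllK k) k = √(X k) * exp (-(π * (lam / 2) ^ 2 * X k)) *
        G (lam / 2) (X k) ∧
      JH1 (lam * EllK k) k = √(X k) * exp (-(π * (lam / 2) ^ 2 * X k)) *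
        (2 * G (lam / 2 / 2) (4 * X k) - G (lam / 2) (X k)) := by
    intro k hk
    have hK : 0 < EllK k := by linarith [pi_div_two_le_EllK hk.1 hk.2, pi_pos]
    have hK' : 0 < EllK' k := by linarith [(EllK'_bounds hk.1 hk.2).1, pi_pos]
    have hx : 0 < X k := div_pos hK hK'
    have ht : EllK' k / EllK k = 1 / X k := by rw [hX, one_div_div]
    have h4 : √(4 * X k) = 2 * √(X k) := by
      rw [sqrt_mul four_pos.le, show (4 : ℝ) = 2 ^ 2 by norm_num, sqrt_sq two_pos.le]
    refine ⟨sqrt_pos.mpr (by nlinarith [hk.1, hk.2]), sqrt_pos.mpr hx, ?_, ?_, ?_⟩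
    · rw [JTheta_eq_cosKernel _ hK hK', ht, cosKernel_one_div_eq_exp _ hx]
    · rw [JTheta1_eq_cosKernel _ hK hK', ht, cosKernel_one_div_eq_exp _ hx]
    · rw [JH1_eq_cosKernel _ hK hK', ht, div_div (1 : ℝ), mul_comm (X k) 4,
        cosKernel_one_div_eq_exp _ hx, cosKernel_one_div_eq_exp _ (mul_pos four_pos hx), h4,
        show π * (lam / 2 / 2) ^ 2 * (4 * X k) = π * (lam / 2) ^ 2 * X k by ring]
      simp only [hG]
      rw [show π * (lam / 2 / 2) ^ 2 * (4 * X k) = π * (lam / 2) ^ 2 * X k by ring]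
      ring
  constructor
  · have h := (hexp.mul (((hG2.const_mul 2).sub hG1).div hG0 one_ne_zero)).div hsqrt one_ne_zero
    norm_num at h
    refine h.congr' ?_
    filter_upwards [Ioo_mem_nhdsLT (zero_lt_one (α := ℝ))] with k hk
    obtain ⟨hy, hx, hT, -, hH⟩ := hforms k hk
    rw [Pi.div_apply]
    rw [← sqrt_mul_exp_div_rpow lam (X k) hy, cn, hT, hH, sqrt_div hy.le]
    field_simp
  · have h := hexp.mul (hG1.div hG0 one_ne_zero)
    norm_num at h
    refine h.congr' ?_
    filter_upwards [Ioo_mem_nhdsLT (zero_lt_one (α := ℝ))] with k hk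
    obtain ⟨hy, hx, hT, hT1, -⟩ := hforms k hk
    rw [← sqrt_mul_exp_div_rpow lam (X k) hy, dn, hT, hT1]
    field_simp
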